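/- Consider a scaling (K_{1,n}, …, K_{r,n}, P_n, α_n) such that Λ_1(n) = c_n · (log n)/n for every n, where c_n → c and 0 < c < 1. Then the probability that the random graph G(n; μ, K_n, P_n, α_n) has no isolated vertices tends to 0 as n → ∞. -/

import Mathlib

open Filter Real

noncomputable section

namespace HetKey

/-- The set of ordered index pairs `x < y` (one Bernoulli coin per unordered pair). -/
abbrev Pairs (n : ℕ) : Type := {p : Fin n × Fin n // p.1 < p.2}

/-- A configuration of the randomness: the class of each vertex, the key ring of each
vertex (a subset of the key pool `{1,…,P}`), and the Bernoulli link coins. -/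
abbrev Config (n r P : ℕ) : Type :=
  (Fin n → Fin r) × (Fin n → Finset (Fin P)) × (Pairs n → Bool)

/-- Weight of a key ring under the uniform distribution on `k`-subsets of the pool. -/
def keyWeight (P k : ℕ) (s : Finset (Fin P)) : ℝ :=
  if s.card = k then ((P.choose k : ℝ))⁻¹ else 0

/-- Probability weight of a configuration: classes are i.i.d. with law `μ`, key rings are
(conditionally) uniform `K (class)`-subsets, link coins are i.i.d. Bernoulli(`α`). -/
def weight {n r P : ℕ} (μ : Fin r → ℝ) (K : Fin r → ℕ) (α : ℝ)
    (cfg : Config n r P) : ℝ :=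
  (∏ x, μ (cfg.1 x) * keyWeight P (K (cfg.1 x)) (cfg.2.1 x)) *
    ∏ p, (if cfg.2.2 p then α else 1 - α)

open scoped Classical in
/-- Probability of an event in `G(n; μ, K, P, α)`. -/
def Pr {n r P : ℕ} (μ : Fin r → ℝ) (K : Fin r → ℕ) (α : ℝ)
    (E : Config n r P → Prop) : ℝ :=
  ∑ cfg, if E cfg then weight μ K α cfg else 0

/-- Expectation of a random variable on the configuration space. -/
def expect {n r P : ℕ} (μ : Fin r → ℝ) (K : Fin r → ℕ) (α : ℝ)
    (X : Config n r P → ℝ) : ℝ :=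
  ∑ cfg, weight μ K α cfg * X cfg

/-- The Bernoulli coin attached to the unordered pair `{x, y}`. -/
def coin {n : ℕ} (b : Pairs n → Bool) (x y : Fin n) : Bool :=
  if h : x < y then b ⟨(x, y), h⟩
  else if h' : y < x then b ⟨(y, x), h'⟩
  else false

/-- Adjacency in `G(n; μ, K, P, α)`: distinct vertices, intersecting key rings, and an
operational (non-failed) link. -/
def adj {n r P : ℕ} (cfg : Config n r P) (x y : Fin n) : Prop :=
  x ≠ y ∧ (cfg.2.1 x ∩ cfg.2.1 y).Nonempty ∧ coin cfg.2.2 x y = true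

/-- A vertex is isolated if it has no neighbours. -/
def isolated {n r P : ℕ} (cfg : Config n r P) (x : Fin n) : Prop :=
  ∀ y, ¬ adj cfg x y

/-- Connectivity: every pair of vertices is joined by a path. -/
def conn {n r P : ℕ} (cfg : Config n r P) : Prop :=
  ∀ x y : Fin n, Relation.ReflTransGen (adj cfg) x y

/-- `p_{ij}`: the probability that a uniform `K_i`-subset and an independent uniform
`K_j`-subset of a pool of size `P` intersect. -/
def pEdge (P Ki Kj : ℕ) : ℝ :=
  1 - ((P - Ki).choose Kj : ℝ) / (P.choose Kj : ℝ)

/-- `λ_i = Σ_j μ_j p_{ij}`. -/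
def lam {r : ℕ} (μ : Fin r → ℝ) (K : Fin r → ℕ) (P : ℕ) (i : Fin r) : ℝ :=
  ∑ j, μ j * pEdge P (K i) (K j)

/-- `Λ_i = α λ_i`. -/
def Lam {r : ℕ} (μ : Fin r → ℝ) (K : Fin r → ℕ) (P : ℕ) (α : ℝ) (i : Fin r) : ℝ :=
  α * lam μ K P i

end HetKey

open HetKey

namespace HetKey

open Finset

/-- Summing a product of one-coordinate functions over all functions. -/
lemma sum_prod_pi {V T : Type*} [Fintype V] [DecidableEq V] [Fintype T] (f : V → T → ℝ) :
    ∑ u : V → T, ∏ z, f z (u z) = ∏ z, ∑ s, f z s := by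
  rw [Finset.prod_univ_sum, Fintype.piFinset_univ]

/-- Probability that the pair of vertices holding key rings `S`, `S'` is not linked. -/
def gap {P : ℕ} (α : ℝ) (S S' : Finset (Fin P)) : ℝ :=
  if Disjoint S S' then 1 else 1 - α

lemma gap_nonneg {P : ℕ} {α : ℝ} (h1 : α ≤ 1) (S S' : Finset (Fin P)) : 0 ≤ gap α S S' := by
  unfold gap; split_ifs <;> linarith

lemma gap_le_one {P : ℕ} {α : ℝ} (h0 : 0 ≤ α) (S S' : Finset (Fin P)) : gap α S S' ≤ 1 := by
  unfold gap; split_ifs <;> linarith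

lemma gap_comm {P : ℕ} (α : ℝ) (S S' : Finset (Fin P)) : gap α S S' = gap α S' S := by
  unfold gap; simp only [disjoint_comm]

/-- Joint weight of a class and a key ring for a single vertex. -/
def nodeWeight {r P : ℕ} (μ : Fin r → ℝ) (K : Fin r → ℕ) (a : Fin r × Finset (Fin P)) : ℝ :=
  μ a.1 * keyWeight P (K a.1) a.2

lemma keyWeight_nonneg (P k : ℕ) (s : Finset (Fin P)) : 0 ≤ keyWeight P k s := by
  unfold keyWeight; split_ifs <;> positivity

lemma nodeWeight_nonneg {r P : ℕ} {μ : Fin r → ℝ} (hμ : ∀ i, 0 ≤ μ i) (K : Fin r → ℕ)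
    (a : Fin r × Finset (Fin P)) : 0 ≤ nodeWeight μ K a :=
  mul_nonneg (hμ _) (keyWeight_nonneg _ _ _)

lemma weight_nonneg {n r P : ℕ} {μ : Fin r → ℝ} (hμ : ∀ i, 0 ≤ μ i) (K : Fin r → ℕ) {α : ℝ}
    (h0 : 0 ≤ α) (h1 : α ≤ 1) (cfg : Config n r P) : 0 ≤ weight μ K α cfg := by
  unfold weight
  refine mul_nonneg (prod_nonneg fun x _ => nodeWeight_nonneg hμ K (cfg.1 x, cfg.2.1 x))
    (prod_nonneg fun p _ => ?_)
  split_ifs <;> linarith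

/-- All vertices of `A` are isolated iff every pair touching `A` whose key rings meet has a
failed link. -/
lemma forall_isolated_iff {n r P : ℕ} (cfg : Config n r P) (A : Finset (Fin n)) :
    (∀ x ∈ A, isolated cfg x) ↔ ∀ p : Pairs n, (p.1.1 ∈ A ∨ p.1.2 ∈ A) ∧
      ¬ Disjoint (cfg.2.1 p.1.1) (cfg.2.1 p.1.2) → cfg.2.2 p = false := by
  simp only [isolated, adj, ← Finset.not_disjoint_iff_nonempty_inter]
  constructor
  · rintro h ⟨⟨u, v⟩, huv⟩ ⟨hA, hd⟩
    simp only at huv hA hd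
    rcases hA with hA | hA
    · have := h u hA v
      simpa [huv.ne, hd, coin, huv] using this
    · have := h v hA u
      simpa [huv.ne', disjoint_comm, hd, coin, huv, huv.not_gt] using this
  · rintro h x hx y ⟨hne, hd, hc⟩
    rcases lt_or_gt_of_ne hne with hlt | hlt
    · have := h ⟨(x, y), hlt⟩ ⟨Or.inl hx, hd⟩
      simp [coin, hlt, this] at hc
    · have := h ⟨(y, x), hlt⟩ ⟨Or.inr hx, by rwa [disjoint_comm]⟩
      simp [coin, hlt, hlt.not_gt, this] at hc

open scoped Classical in
lemma sum_coins {ι : Type*} [Fintype ι] [DecidableEq ι] (α : ℝ) (Q : ι → Prop)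
    [DecidablePred Q] :
    ∑ b : ι → Bool, (∏ p, if b p then α else 1 - α) *
      (if ∀ p, Q p → b p = false then 1 else 0) = ∏ p, if Q p then 1 - α else 1 := by
  have h : ∀ b : ι → Bool, (∏ p, if b p then α else 1 - α) *
      (if ∀ p, Q p → b p = false then (1 : ℝ) else 0) =
      ∏ p, (if b p then α else 1 - α) * (if Q p → b p = false then 1 else 0) := by
    intro b
    rw [prod_mul_distrib]
    congr 1
    rw [Finset.prod_ite_zero]
    simp
  simp_rw [h]
  rw [sum_prod_pi (fun p (b : Bool) => (if b then α else 1 - α) *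
    (if Q p → b = false then (1 : ℝ) else 0))]
  refine prod_congr rfl fun p _ => ?_
  by_cases hQ : Q p <;> simp [hQ]

open scoped Classical in
/-- Averaging over the link coins. -/
lemma expect_isolated {n r P : ℕ} (μ : Fin r → ℝ) (K : Fin r → ℕ) (α : ℝ) (i : Fin r)
    (A : Finset (Fin n)) :
    expect μ K α (fun cfg : Config n r P =>
        if ∀ x ∈ A, cfg.1 x = i ∧ isolated cfg x then 1 else 0) =
      ∑ u : Fin n → Fin r × Finset (Fin P), (∏ z, nodeWeight μ K (u z)) *
        ((if ∀ x ∈ A, (u x).1 = i then 1 else 0) *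
        ∏ p : Pairs n, if (p.1.1 ∈ A ∨ p.1.2 ∈ A) then gap α (u p.1.1).2 (u p.1.2).2 else 1) := by
  have key : ∀ (t : Fin n → Fin r) (S : Fin n → Finset (Fin P)),
      ∑ b, weight μ K α (t, S, b) * (if ∀ x ∈ A, t x = i ∧ isolated (t, S, b) x then 1 else 0) =
      (∏ z, nodeWeight μ K (t z, S z)) * ((if ∀ x ∈ A, t x = i then 1 else 0) *
        ∏ p : Pairs n, if (p.1.1 ∈ A ∨ p.1.2 ∈ A) then gap α (S p.1.1) (S p.1.2) else 1) := by
    intro t S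
    have hp : ∀ p : Pairs n, (if (p.1.1 ∈ A ∨ p.1.2 ∈ A) then gap α (S p.1.1) (S p.1.2) else 1)
        = if (p.1.1 ∈ A ∨ p.1.2 ∈ A) ∧ ¬ Disjoint (S p.1.1) (S p.1.2) then 1 - α else 1 := by
      intro p; unfold gap; split_ifs <;> tauto
    simp_rw [hp]
    rw [← sum_coins, mul_sum, mul_sum]
    refine sum_congr rfl fun b _ => ?_
    have hiff : (∀ x ∈ A, t x = i ∧ isolated (t, S, b) x) ↔ (∀ x ∈ A, t x = i) ∧
        ∀ p : Pairs n, (p.1.1 ∈ A ∨ p.1.2 ∈ A) ∧ ¬ Disjoint (S p.1.1) (S p.1.2) →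
          b p = false := by
      rw [← forall_isolated_iff (t, S, b) A]
      exact forall₂_and
    simp only [hiff, weight, nodeWeight, ite_and]
    split_ifs <;> simp
  unfold expect
  rw [Fintype.sum_prod_type]
  simp_rw [Fintype.sum_prod_type, key]
  rw [← Fintype.sum_prod_type',
    ← (Equiv.arrowProdEquivProdArrow (Fin n) (fun _ => Fin r) (fun _ => Finset (Fin P))).sum_comp]
  rfl

/-- A product over pairs containing `x` is a product over the other vertices. -/
lemma prod_pairs_star {n : ℕ} (x : Fin n) (g : Fin n → ℝ) :
    ∏ p : Pairs n, (if p.1.1 = x then g p.1.2 else if p.1.2 = x then g p.1.1 else 1) =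
      ∏ z, if z = x then 1 else g z := by
  have h1 : ∏ p : Pairs n, (if p.1.1 = x then g p.1.2 else if p.1.2 = x then g p.1.1 else 1) =
      ∏ q : Fin n × Fin n, if q.1 < q.2 then
        (if q.1 = x then g q.2 else if q.2 = x then g q.1 else 1) else 1 := by
    rw [← prod_filter, ← Finset.prod_subtype_eq_prod_filter]
    simp [Pairs]
  have h2 : ∀ u v : Fin n, (if u < v then
      (if u = x then g v else if v = x then g u else 1) else 1) =
      (if u = x then (if x < v then g v else 1) else 1) *
      (if v = x then (if u < x then g u else 1) else 1) := by
    intro u v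
    by_cases hu : u = x <;> by_cases hv : v = x
    · subst hu; subst hv; simp
    · subst hu; simp [hv]
    · subst hv; simp [hu]
    · simp [hu, hv]
  rw [h1, Fintype.prod_prod_type]
  simp_rw [h2, prod_mul_distrib]
  rw [Finset.prod_comm]
  simp only [prod_ite_eq', mem_univ, if_true]
  rw [← prod_mul_distrib]
  refine prod_congr rfl fun z _ => ?_
  rcases lt_trichotomy z x with h | h | h
  · simp [h, h.ne, h.not_gt]
  · simp [h]
  · simp [h, h.ne', h.not_gt]

/-- Conditioning on the value of one coordinate. -/
lemma sum_pi_condition_one {V T : Type*} [Fintype V] [DecidableEq V] [Fintype T] [DecidableEq T]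
    (ν : T → ℝ) (x : V) (G : T → ℝ) (h : T → T → ℝ) :
    ∑ u : V → T, (∏ z, ν (u z)) * (G (u x) * ∏ z, if z = x then 1 else h (u x) (u z)) =
      ∑ a, ν a * G a * (∑ s, ν s * h a s) ^ (Fintype.card V - 1) := by
  have h1 : ∀ u : V → T,
      (∏ z, ν (u z)) * (G (u x) * ∏ z, if z = x then 1 else h (u x) (u z)) =
      ∑ a, ∏ z, if z = x then (if u z = a then ν a * G a else 0) else ν (u z) * h a (u z) := by
    intro u
    have h2 : ∀ a, (∏ z, if z = x then (if u z = a then ν a * G a else 0)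
        else ν (u z) * h a (u z)) = if u x = a then
          ν a * G a * ∏ z ∈ univ.erase x, ν (u z) * h a (u z) else 0 := by
      intro a
      rw [← mul_prod_erase univ _ (mem_univ x)]
      simp only [if_true, ite_mul, zero_mul]
      congr 2
      exact prod_congr rfl fun z hz => by simp [(mem_erase.1 hz).1]
    simp_rw [h2]
    rw [sum_ite_eq, if_pos (mem_univ _), ← mul_prod_erase univ _ (mem_univ x),
      ← mul_prod_erase univ (fun z => if z = x then 1 else h (u x) (u z)) (mem_univ x),
      prod_mul_distrib]
    rw [prod_congr (s₁ := univ.erase x) (f := fun z => if z = x then 1 else h (u x) (u z)) rfl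
      fun z hz => if_neg (mem_erase.1 hz).1]
    simp only [if_true]
    ring
  simp_rw [h1]
  rw [Finset.sum_comm]
  refine sum_congr rfl fun a _ => ?_
  rw [sum_prod_pi (fun z s => if z = x then (if s = a then ν a * G a else 0) else ν s * h a s),
    ← mul_prod_erase univ _ (mem_univ x)]
  rw [prod_congr rfl (g := fun z => ∑ s, ν s * h a s)
      fun z hz => by simp [(mem_erase.1 hz).1]]
  simp [card_erase_of_mem]

/-- Conditioning on the values of two coordinates. -/
lemma sum_pi_condition_two {V T : Type*} [Fintype V] [DecidableEq V] [Fintype T] [DecidableEq T]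
    (ν : T → ℝ) {x y : V} (hxy : x ≠ y) (G : T → T → ℝ) (h : T → T → T → ℝ) :
    ∑ u : V → T, (∏ z, ν (u z)) * (G (u x) (u y) *
        ∏ z, if z = x ∨ z = y then 1 else h (u x) (u y) (u z)) =
      ∑ a, ∑ b, ν a * ν b * G a b * (∑ s, ν s * h a b s) ^ (Fintype.card V - 2) := by
  have split : ∀ f : V → ℝ, ∏ z, f z = f x * (f y * ∏ z ∈ (univ.erase x).erase y, f z) := by
    intro f
    rw [← mul_prod_erase univ _ (mem_univ x),
      ← mul_prod_erase (univ.erase x) _ (mem_erase.2 ⟨hxy.symm, mem_univ y⟩)]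
  have hmem : ∀ z ∈ (univ.erase x).erase y, z ≠ x ∧ z ≠ y := by
    intro z hz
    simp only [mem_erase, mem_univ, and_true] at hz
    exact hz.symm
  have h1 : ∀ u : V → T,
      (∏ z, ν (u z)) * (G (u x) (u y) *
        ∏ z, if z = x ∨ z = y then 1 else h (u x) (u y) (u z)) =
      ∑ a, ∑ b, ∏ z, if z = x then (if u z = a then ν a * G a b else 0) else
        if z = y then (if u z = b then ν b else 0) else ν (u z) * h a b (u z) := by
    intro u
    have h2 : ∀ a b, (∏ z, if z = x then (if u z = a then ν a * G a b else 0) else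
        if z = y then (if u z = b then ν b else 0) else ν (u z) * h a b (u z)) =
        if u x = a then (if u y = b then ν a * ν b * G a b *
          ∏ z ∈ (univ.erase x).erase y, ν (u z) * h a b (u z) else 0) else 0 := by
      intro a b
      rw [split]
      rw [prod_congr rfl (g := fun z => ν (u z) * h a b (u z))
        fun z hz => by simp [(hmem z hz).1, (hmem z hz).2]]
      simp only [if_true, hxy.symm, if_false]
      split_ifs <;> ring
    simp_rw [h2]
    simp only [sum_ite_eq, mem_univ, if_true, sum_ite_irrel, sum_const_zero]
    rw [split, split (fun z => if z = x ∨ z = y then 1 else h (u x) (u y) (u z)),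
      prod_mul_distrib]
    rw [prod_congr (s₁ := (univ.erase x).erase y)
      (f := fun z => if z = x ∨ z = y then 1 else h (u x) (u y) (u z)) rfl
      fun z hz => if_neg (not_or.2 (hmem z hz))]
    simp only [true_or, or_true, if_true]
    ring
  simp_rw [h1]
  rw [Finset.sum_comm]
  refine sum_congr rfl fun a _ => ?_
  rw [Finset.sum_comm]
  refine sum_congr rfl fun b _ => ?_
  rw [sum_prod_pi (fun z s => if z = x then (if s = a then ν a * G a b else 0) else
        if z = y then (if s = b then ν b else 0) else ν s * h a b s), split]
  rw [prod_congr rfl (g := fun z => ∑ s, ν s * h a b s)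
      fun z hz => by simp [(hmem z hz).1, (hmem z hz).2]]
  have hc : ((univ.erase x).erase y).card = Fintype.card V - 2 := by
    rw [card_erase_of_mem (mem_erase.2 ⟨hxy.symm, mem_univ y⟩), card_erase_of_mem (mem_univ x),
      card_univ]
    omega
  simp [hc, hxy.symm]
  ring

open scoped Classical in
lemma expect_isolated_one {n r P : ℕ} (μ : Fin r → ℝ) (K : Fin r → ℕ) (α : ℝ) (i : Fin r)
    (x : Fin n) :
    expect μ K α (fun cfg : Config n r P => if cfg.1 x = i ∧ isolated cfg x then 1 else 0) =
      ∑ a : Fin r × Finset (Fin P), nodeWeight μ K a * (if a.1 = i then 1 else 0) *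
        (∑ s : Fin r × Finset (Fin P), nodeWeight μ K s * gap α a.2 s.2) ^ (n - 1) := by
  have h := expect_isolated (P := P) μ K α i {x}
  simp only [mem_singleton, forall_eq] at h
  rw [h]
  have h2 := sum_pi_condition_one (nodeWeight (P := P) μ K) x (fun a => if a.1 = i then 1 else 0)
    (fun a s => gap α a.2 s.2)
  rw [Fintype.card_fin] at h2
  rw [← h2]
  refine sum_congr rfl fun u _ => ?_
  rw [← prod_pairs_star x (fun z => gap α (u x).2 (u z).2)]
  congr 2
  refine prod_congr rfl fun p _ => ?_
  by_cases h1 : p.1.1 = x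
  · simp [h1]
  · by_cases h3 : p.1.2 = x
    · simp [h1, h3, gap_comm]
    · simp [h1, h3]

open scoped Classical in
lemma expect_isolated_two_le {n r P : ℕ} {μ : Fin r → ℝ} (hμ : ∀ i, 0 ≤ μ i) (K : Fin r → ℕ)
    {α : ℝ} (h0 : 0 ≤ α) (h1 : α ≤ 1) (i : Fin r) {x y : Fin n} (hxy : x ≠ y) :
    expect μ K α (fun cfg : Config n r P =>
        if (cfg.1 x = i ∧ isolated cfg x) ∧ (cfg.1 y = i ∧ isolated cfg y) then 1 else 0) ≤
      ∑ a : Fin r × Finset (Fin P), ∑ b : Fin r × Finset (Fin P),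
        nodeWeight μ K a * nodeWeight μ K b *
          ((if a.1 = i then 1 else 0) * (if b.1 = i then 1 else 0)) *
        (∑ s : Fin r × Finset (Fin P),
          nodeWeight μ K s * (gap α a.2 s.2 * gap α b.2 s.2)) ^ (n - 2) := by
  have h := expect_isolated (P := P) μ K α i {x, y}
  simp only [mem_insert, mem_singleton, forall_eq_or_imp, forall_eq] at h
  rw [h]
  have h2 := sum_pi_condition_two (nodeWeight (P := P) μ K) hxy
    (fun a b => (if a.1 = i then 1 else 0) * (if b.1 = i then 1 else 0))
    (fun a b s => gap α a.2 s.2 * gap α b.2 s.2)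
  rw [Fintype.card_fin] at h2
  rw [← h2]
  clear h h2
  refine sum_le_sum fun u _ => ?_
  refine mul_le_mul_of_nonneg_left ?_ (prod_nonneg fun z _ => nodeWeight_nonneg hμ K _)
  have hind : ∀ (p q : Prop) [Decidable p] [Decidable q], (if p ∧ q then (1 : ℝ) else 0) =
      (if p then 1 else 0) * (if q then 1 else 0) := by
    intro p q _ _
    by_cases hp : p <;> by_cases hq : q <;> simp [hp, hq]
  rw [hind]
  refine mul_le_mul_of_nonneg_left ?_ (by split_ifs <;> norm_num)
  have hprod : (∏ z, if z = x ∨ z = y then (1 : ℝ) else gap α (u x).2 (u z).2 *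
      gap α (u y).2 (u z).2) =
      (∏ z, if z = x then 1 else if z = y then 1 else gap α (u x).2 (u z).2) *
      ∏ z, if z = y then 1 else if z = x then 1 else gap α (u y).2 (u z).2 := by
    rw [← prod_mul_distrib]
    refine prod_congr rfl fun z _ => ?_
    by_cases hx : z = x <;> by_cases hy : z = y <;> simp [hx, hy]
  rw [hprod, ← prod_pairs_star x (fun z => if z = y then 1 else gap α (u x).2 (u z).2),
    ← prod_pairs_star y (fun z => if z = x then 1 else gap α (u y).2 (u z).2),
    ← prod_mul_distrib]
  refine prod_le_prod (fun p _ => ?_) fun p _ => ?_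
  · split_ifs
    · exact gap_nonneg h1 _ _
    · exact zero_le_one
  · have hle := gap_le_one h0 (u p.1.1).2 (u p.1.2).2
    have hc := gap_comm α (u p.1.1).2 (u p.1.2).2
    rcases p with ⟨⟨v, w⟩, hvw⟩
    simp only at hle hc hvw ⊢
    by_cases hvx : v = x
    · subst hvx
      by_cases hwy : w = y
      · subst hwy; simpa [hxy] using hle
      · simp [hwy, hxy, hvw.ne']
    · by_cases hvy : v = y
      · subst hvy
        by_cases hwx : w = x
        · subst hwx; simpa [hxy, hvw.ne] using hle
        · simp [hvx, hwx, hvw.ne']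
      · by_cases hwx : w = x
        · subst hwx; simp [hvx, hvy, hxy, hc]
        · by_cases hwy : w = y
          · subst hwy; simp [hvx, hvy, hwx, hc]
          · simp [hvx, hvy, hwx, hwy]

lemma sum_keyWeight_disjoint {P k : ℕ} (S : Finset (Fin P)) :
    ∑ s, keyWeight P k s * (if Disjoint S s then 1 else 0) =
      ((P - S.card).choose k : ℝ) / (P.choose k : ℝ) := by
  have h : ∀ s : Finset (Fin P), keyWeight P k s * (if Disjoint S s then 1 else 0) =
      if s ∈ powersetCard k Sᶜ then ((P.choose k : ℝ))⁻¹ else 0 := by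
    intro s
    have hs : s ⊆ Sᶜ ↔ Disjoint S s := by
      rw [subset_compl_comm, subset_compl_iff_disjoint_right]
    unfold keyWeight
    simp only [mem_powersetCard, hs]
    by_cases h1 : s.card = k <;> by_cases h2 : Disjoint S s <;> simp [h1, h2]
  simp_rw [h]
  rw [sum_ite_mem, univ_inter, sum_const, card_powersetCard, card_compl, Fintype.card_fin,
    nsmul_eq_mul, div_eq_mul_inv]

lemma sum_keyWeight {P k : ℕ} (hk : k ≤ P) : ∑ s, keyWeight P k s = 1 := by
  have h := sum_keyWeight_disjoint (P := P) (k := k) ∅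
  have hpos : (P.choose k : ℝ) ≠ 0 := by exact_mod_cast (Nat.choose_pos hk).ne'
  simpa [hpos] using h

lemma pEdge_nonneg {P k : ℕ} (m : ℕ) : 0 ≤ pEdge P m k := by
  unfold pEdge
  rw [sub_nonneg]
  refine div_le_one_of_le₀ ?_ (Nat.cast_nonneg _)
  exact_mod_cast Nat.choose_le_choose k (Nat.sub_le P m)

lemma choose_sub_two_mul_mul_le (P m k : ℕ) :
    (P - 2 * m).choose k * P.choose k ≤ (P - m).choose k ^ 2 := by
  have h : (P - 2 * m).descFactorial k * P.descFactorial k ≤ (P - m).descFactorial k ^ 2 := by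
    simp only [Nat.descFactorial_eq_prod_range]
    rw [← prod_mul_distrib, ← prod_pow]
    refine prod_le_prod' fun j _ => ?_
    rcases le_total P (2 * m + j) with hle | hle
    · have : P - 2 * m - j = 0 := by omega
      simp [this]
    · obtain ⟨d, rfl⟩ := Nat.exists_eq_add_of_le hle
      have e1 : 2 * m + j + d - 2 * m - j = d := by omega
      have e2 : 2 * m + j + d - j = 2 * m + d := by omega
      have e3 : 2 * m + j + d - m - j = m + d := by omega
      rw [e1, e2, e3]
      nlinarith
  simp only [Nat.descFactorial_eq_factorial_mul_choose] at h
  have hk := Nat.factorial_pos k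
  refine le_of_mul_le_mul_left (a := k.factorial ^ 2) ?_ (pow_pos hk 2)
  calc _ = _ := by ring
    _ ≤ _ := h
    _ = _ := by ring

lemma sum_keyWeight_gap {P k m : ℕ} (hk : k ≤ P) (α : ℝ) {S : Finset (Fin P)} (hS : S.card = m) :
    ∑ s, keyWeight P k s * gap α S s = 1 - α * pEdge P m k := by
  have h : ∀ s : Finset (Fin P), keyWeight P k s * gap α S s = (1 - α) * keyWeight P k s +
      α * (keyWeight P k s * (if Disjoint S s then 1 else 0)) := by
    intro s; unfold gap; split_ifs <;> ring
  simp_rw [h, sum_add_distrib, ← mul_sum, sum_keyWeight_disjoint, sum_keyWeight hk, hS, pEdge]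
  ring

lemma sum_keyWeight_gap_mul_gap_le {P k m : ℕ} (hk : k ≤ P) (α : ℝ)
    {A B : Finset (Fin P)} (hA : A.card = m) (hB : B.card = m) :
    ∑ s, keyWeight P k s * (gap α A s * gap α B s) ≤ 1 - 2 * (α * pEdge P m k) +
      (α * pEdge P m k) ^ 2 + (if Disjoint A B then 0 else α * (α * pEdge P m k)) := by
  have hC : (0 : ℝ) < P.choose k := by exact_mod_cast Nat.choose_pos hk
  set q : ℝ := ((P - m).choose k : ℝ) / (P.choose k : ℝ) with hq
  have hp : pEdge P m k = 1 - q := rfl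
  have hdA := sum_keyWeight_disjoint (k := k) A
  have hdB := sum_keyWeight_disjoint (k := k) B
  rw [hA, ← hq] at hdA
  rw [hB, ← hq] at hdB
  have h : ∀ s : Finset (Fin P), keyWeight P k s * (gap α A s * gap α B s) =
      (1 - α) ^ 2 * keyWeight P k s +
      α * (1 - α) * (keyWeight P k s * (if Disjoint A s then 1 else 0)) +
      α * (1 - α) * (keyWeight P k s * (if Disjoint B s then 1 else 0)) +
      α ^ 2 * (keyWeight P k s * (if Disjoint (A ∪ B) s then 1 else 0)) := by
    intro s
    unfold gap
    simp only [disjoint_union_left]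
    by_cases h1 : Disjoint A s <;> by_cases h2 : Disjoint B s <;> simp [h1, h2] <;> ring
  simp_rw [h, sum_add_distrib, ← mul_sum, hdA, hdB, sum_keyWeight hk, hp]
  split_ifs with hd
  · rw [sum_keyWeight_disjoint, card_union_of_disjoint hd, hA, hB, ← two_mul]
    have h2 : ((P - 2 * m).choose k : ℝ) / (P.choose k : ℝ) ≤ q ^ 2 := by
      rw [hq, div_pow, div_le_div_iff₀ hC (pow_pos hC 2)]
      have := choose_sub_two_mul_mul_le P m k
      have h3 : ((P - 2 * m).choose k : ℝ) * P.choose k ≤ ((P - m).choose k : ℝ) ^ 2 := by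
        exact_mod_cast this
      nlinarith
    nlinarith [mul_le_mul_of_nonneg_left h2 (sq_nonneg α)]
  · have h2 : ∑ s, keyWeight P k s * (if Disjoint (A ∪ B) s then 1 else 0) ≤ q := by
      rw [← hdA]
      refine sum_le_sum fun s _ => mul_le_mul_of_nonneg_left ?_ (keyWeight_nonneg _ _ _)
      simp only [disjoint_union_left]
      by_cases h1 : Disjoint A s <;> by_cases h2 : Disjoint B s <;> simp [h1, h2]
    nlinarith [mul_le_mul_of_nonneg_left h2 (sq_nonneg α), sq_nonneg (α * (1 - q))]

lemma sum_nodeWeight_mul {r P : ℕ} (μ : Fin r → ℝ) (K : Fin r → ℕ)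
    (f : Finset (Fin P) → ℝ) :
    ∑ a : Fin r × Finset (Fin P), nodeWeight μ K a * f a.2 =
      ∑ j, μ j * ∑ s, keyWeight P (K j) s * f s := by
  rw [Fintype.sum_prod_type]
  simp only [nodeWeight, mul_sum, mul_assoc]

lemma sum_nodeWeight_class {r P : ℕ} (μ : Fin r → ℝ) (K : Fin r → ℕ) (i : Fin r)
    (f : Finset (Fin P) → ℝ) :
    ∑ a : Fin r × Finset (Fin P), nodeWeight μ K a * (if a.1 = i then 1 else 0) * f a.2 =
      μ i * ∑ s, keyWeight P (K i) s * f s := by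
  rw [Fintype.sum_prod_type, Fintype.sum_eq_single i]
  · simp only [nodeWeight, if_true, mul_one, mul_sum, mul_assoc]
  · intro j hj
    simp [hj]

lemma keyWeight_mul_congr {P k : ℕ} {s : Finset (Fin P)} {x y : ℝ} (h : s.card = k → x = y) :
    keyWeight P k s * x = keyWeight P k s * y := by
  unfold keyWeight
  split_ifs with hs
  · rw [h hs]
  · simp

lemma keyWeight_mul_le {P k : ℕ} {s : Finset (Fin P)} {x y : ℝ} (h : s.card = k → x ≤ y) :
    keyWeight P k s * x ≤ keyWeight P k s * y := by
  by_cases hs : s.card = k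
  · exact mul_le_mul_of_nonneg_left (h hs) (keyWeight_nonneg _ _ _)
  · simp [keyWeight, hs]

lemma sum_nodeWeight_gap {r P : ℕ} {μ : Fin r → ℝ} (hμsum : ∑ i, μ i = 1)
    {K : Fin r → ℕ} (hK : ∀ i, K i ≤ P) (α : ℝ) (i : Fin r) {S : Finset (Fin P)}
    (hS : S.card = K i) :
    ∑ s : Fin r × Finset (Fin P), nodeWeight μ K s * gap α S s.2 = 1 - Lam μ K P α i := by
  rw [sum_nodeWeight_mul μ K (gap α S)]
  simp_rw [sum_keyWeight_gap (hK _) α hS, mul_sub, sum_sub_distrib, mul_one, hμsum, Lam, lam,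
    mul_sum]
  congr 1
  exact sum_congr rfl fun j _ => by ring

lemma mul_pEdge_le_Lam {r P : ℕ} {μ : Fin r → ℝ} (hμ : ∀ i, 0 ≤ μ i) (K : Fin r → ℕ) {α : ℝ}
    (h0 : 0 ≤ α) (i j : Fin r) : μ j * (α * pEdge P (K i) (K j)) ≤ Lam μ K P α i := by
  have h : μ j * pEdge P (K i) (K j) ≤ lam μ K P i :=
    single_le_sum (f := fun j => μ j * pEdge P (K i) (K j))
      (fun j _ => mul_nonneg (hμ j) (pEdge_nonneg _)) (mem_univ j)
  calc _ = α * (μ j * pEdge P (K i) (K j)) := by ring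
    _ ≤ _ := mul_le_mul_of_nonneg_left h h0

lemma sum_nodeWeight_gap_mul_gap_le {r P : ℕ} {μ : Fin r → ℝ} (hμ : ∀ i, 0 < μ i)
    (hμsum : ∑ i, μ i = 1) {K : Fin r → ℕ} (hK : ∀ i, K i ≤ P) {α : ℝ} (h0 : 0 ≤ α)
    (i : Fin r) {A B : Finset (Fin P)} (hA : A.card = K i) (hB : B.card = K i) :
    ∑ s : Fin r × Finset (Fin P), nodeWeight μ K s * (gap α A s.2 * gap α B s.2) ≤
      1 - 2 * Lam μ K P α i + (∑ j, (μ j)⁻¹) * Lam μ K P α i ^ 2 +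
        (if Disjoint A B then 0 else α * Lam μ K P α i) := by
  rw [sum_nodeWeight_mul μ K (fun s => gap α A s * gap α B s)]
  set e : ℝ := if Disjoint A B then 0 else α with he
  have hLam : Lam μ K P α i = ∑ j, μ j * (α * pEdge P (K i) (K j)) := by
    rw [Lam, lam, mul_sum]
    exact sum_congr rfl fun j _ => by ring
  calc ∑ j, μ j * ∑ s, keyWeight P (K j) s * (gap α A s * gap α B s)
      ≤ ∑ j, (μ j - 2 * (μ j * (α * pEdge P (K i) (K j))) + (μ j)⁻¹ * Lam μ K P α i ^ 2 +
          e * (μ j * (α * pEdge P (K i) (K j)))) := by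
        refine sum_le_sum fun j _ => ?_
        have hj := mul_le_mul_of_nonneg_left
          (sum_keyWeight_gap_mul_gap_le (hK j) α hA hB) (hμ j).le
        have hsq : μ j * (α * pEdge P (K i) (K j)) ^ 2 ≤ (μ j)⁻¹ * Lam μ K P α i ^ 2 := by
          rw [inv_mul_eq_div, le_div_iff₀ (hμ j)]
          calc _ = (μ j * (α * pEdge P (K i) (K j))) ^ 2 := by ring
            _ ≤ _ := pow_le_pow_left₀ (mul_nonneg (hμ j).le (mul_nonneg h0 (pEdge_nonneg _)))
                (mul_pEdge_le_Lam (fun j => (hμ j).le) K h0 i j) 2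
        have hee : (if Disjoint A B then 0 else α * (α * pEdge P (K i) (K j))) =
            e * (α * pEdge P (K i) (K j)) := by
          rw [he]; split_ifs <;> ring
        rw [hee] at hj
        linarith
    _ = _ := by
        rw [sum_add_distrib, sum_add_distrib, sum_sub_distrib, ← mul_sum, ← mul_sum, ← sum_mul,
          ← hLam, hμsum, he]
        split_ifs <;> ring

open scoped Classical in
lemma expect_isolated_one_eq {n r P : ℕ} {μ : Fin r → ℝ} (hμsum : ∑ i, μ i = 1)
    {K : Fin r → ℕ} (hK : ∀ i, K i ≤ P) (α : ℝ) (i : Fin r) (x : Fin n) :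
    expect μ K α (fun cfg : Config n r P => if cfg.1 x = i ∧ isolated cfg x then 1 else 0) =
      μ i * (1 - Lam μ K P α i) ^ (n - 1) := by
  rw [expect_isolated_one, sum_nodeWeight_class μ K i
    (fun A => (∑ s : Fin r × Finset (Fin P), nodeWeight μ K s * gap α A s.2) ^ (n - 1))]
  rw [sum_congr rfl fun S _ => keyWeight_mul_congr fun hS => by
    rw [sum_nodeWeight_gap hμsum hK α i hS]]
  rw [← sum_mul, sum_keyWeight (hK i), one_mul]

lemma sum_keyWeight_meet {P k : ℕ} (hk : k ≤ P) (E : ℝ) :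
    ∑ A, keyWeight P k A * ∑ B, keyWeight P k B * (if Disjoint A B then 1 else E) =
      1 + pEdge P k k * (E - 1) := by
  have h : ∀ A : Finset (Fin P), keyWeight P k A *
      ∑ B, keyWeight P k B * (if Disjoint A B then 1 else E) =
      keyWeight P k A * (1 + pEdge P k k * (E - 1)) := by
    intro A
    refine keyWeight_mul_congr fun hA => ?_
    have := sum_keyWeight_gap hk (1 - E) hA
    simp only [gap, sub_sub_cancel] at this
    rw [this]
    ring
  simp_rw [h]
  rw [← sum_mul, sum_keyWeight hk, one_mul]

open scoped Classical in
lemma expect_isolated_two_le_exp {n r P : ℕ} {μ : Fin r → ℝ} (hμ : ∀ i, 0 < μ i)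
    (hμsum : ∑ i, μ i = 1) {K : Fin r → ℕ} (hK : ∀ i, K i ≤ P) {α : ℝ} (h0 : 0 ≤ α) (h1 : α ≤ 1)
    (i : Fin r) {x y : Fin n} (hxy : x ≠ y) {L M : ℝ} (hL : Lam μ K P α i = L) (hL0 : 0 ≤ L)
    (hL1 : L < 1) (hM : M = n * L / (1 - L) ^ 2) :
    expect μ K α (fun cfg : Config n r P =>
        if (cfg.1 x = i ∧ isolated cfg x) ∧ (cfg.1 y = i ∧ isolated cfg y) then 1 else 0) ≤
      μ i ^ 2 * ((1 - L) ^ 2) ^ (n - 2) * (Real.exp ((∑ j, (μ j)⁻¹) * (M * L)) *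
        (1 + L * M * Real.exp M / μ i)) := by
  set C := ∑ j, (μ j)⁻¹ with hC
  have hC0 : 0 ≤ C := sum_nonneg fun j _ => (inv_pos.2 (hμ j)).le
  have hb : 0 < (1 - L) ^ 2 := pow_pos (sub_pos.2 hL1) 2
  have hM0 : 0 ≤ M := by rw [hM]; positivity
  have hpow : ∀ A B : Finset (Fin P), A.card = K i → B.card = K i →
      (∑ s : Fin r × Finset (Fin P), nodeWeight μ K s * (gap α A s.2 * gap α B s.2)) ^ (n - 2) ≤
      ((1 - L) ^ 2) ^ (n - 2) * Real.exp (C * (M * L)) *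
        (if Disjoint A B then 1 else Real.exp (α * M)) := by
    intro A B hA hB
    have hle := sum_nodeWeight_gap_mul_gap_le hμ hμsum hK h0 i hA hB
    rw [hL, ← hC] at hle
    set e : ℝ := if Disjoint A B then 0 else α with he
    have he0 : 0 ≤ e := by rw [he]; split_ifs <;> simp [h0]
    have hee : (if Disjoint A B then 0 else α * L) = e * L := by rw [he]; split_ifs <;> ring
    have hE : (if Disjoint A B then 1 else Real.exp (α * M)) = Real.exp (e * M) := by
      rw [he]; split_ifs <;> simp
    rw [hee] at hle
    rw [hE, mul_assoc, ← Real.exp_add]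
    set X := (C * L ^ 2 + e * L) / (1 - L) ^ 2 with hX
    have hX0 : 0 ≤ X := by positivity
    have hle2 : 1 - 2 * L + C * L ^ 2 + e * L ≤ (1 - L) ^ 2 * Real.exp X := by
      have := mul_le_mul_of_nonneg_left (Real.add_one_le_exp X) hb.le
      have h3 : (1 - L) ^ 2 * X = C * L ^ 2 + e * L := by
        rw [hX, mul_div_cancel₀ _ hb.ne']
      nlinarith [sq_nonneg L]
    have hnn : 0 ≤ ∑ s : Fin r × Finset (Fin P),
        nodeWeight μ K s * (gap α A s.2 * gap α B s.2) :=
      sum_nonneg fun s _ => mul_nonneg (nodeWeight_nonneg (fun i => (hμ i).le) K s)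
        (mul_nonneg (gap_nonneg h1 _ _) (gap_nonneg h1 _ _))
    calc _ ≤ ((1 - L) ^ 2 * Real.exp X) ^ (n - 2) :=
          pow_le_pow_left₀ hnn (hle.trans hle2) _
      _ = ((1 - L) ^ 2) ^ (n - 2) * Real.exp ((n - 2 : ℕ) * X) := by
          rw [mul_pow, ← Real.exp_nat_mul]
      _ ≤ _ := by
          refine mul_le_mul_of_nonneg_left (Real.exp_le_exp.2 ?_) (by positivity)
          calc ((n - 2 : ℕ) : ℝ) * X ≤ n * X :=
                mul_le_mul_of_nonneg_right (by exact_mod_cast Nat.sub_le n 2) hX0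
            _ = _ := by rw [hX, hM]; ring
  refine (expect_isolated_two_le (fun i => (hμ i).le) K h0 h1 i hxy).trans ?_
  have hsum : ∀ X : Finset (Fin P) → Finset (Fin P) → ℝ,
      ∑ a : Fin r × Finset (Fin P), ∑ b : Fin r × Finset (Fin P),
        nodeWeight μ K a * nodeWeight μ K b *
          ((if a.1 = i then 1 else 0) * (if b.1 = i then 1 else 0)) * X a.2 b.2 =
      μ i ^ 2 * ∑ A, keyWeight P (K i) A * ∑ B, keyWeight P (K i) B * X A B := by
    intro X
    have := sum_nodeWeight_class μ K i
      (fun A => μ i * ∑ B : Finset (Fin P), keyWeight P (K i) B * X A B)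
    simp_rw [← sum_nodeWeight_class μ K i (X _)] at this ⊢
    rw [sq, mul_assoc, mul_sum]
    simp_rw [mul_left_comm (μ i) (keyWeight _ _ _), ← sum_nodeWeight_class μ K i (X _)]
    rw [← this]
    refine sum_congr rfl fun a _ => ?_
    rw [mul_sum]
    exact sum_congr rfl fun b _ => by ring
  rw [hsum (fun A B => (∑ s : Fin r × Finset (Fin P),
    nodeWeight μ K s * (gap α A s.2 * gap α B s.2)) ^ (n - 2)), mul_assoc]
  refine mul_le_mul_of_nonneg_left ?_ (sq_nonneg _)
  calc _ ≤ ∑ A, keyWeight P (K i) A * ∑ B, keyWeight P (K i) B *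
        (((1 - L) ^ 2) ^ (n - 2) * Real.exp (C * (M * L)) *
        (if Disjoint A B then 1 else Real.exp (α * M))) :=
        sum_le_sum fun A _ => keyWeight_mul_le fun hA =>
          sum_le_sum fun B _ => keyWeight_mul_le fun hB => hpow A B hA hB
    _ = ((1 - L) ^ 2) ^ (n - 2) * Real.exp (C * (M * L)) *
        (1 + pEdge P (K i) (K i) * (Real.exp (α * M) - 1)) := by
        rw [← sum_keyWeight_meet (hK i), mul_sum]
        refine sum_congr rfl fun A _ => ?_
        rw [mul_left_comm (_ * _) (keyWeight P (K i) A)]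
        congr 1
        rw [mul_sum]
        exact sum_congr rfl fun B _ => by ring
    _ ≤ ((1 - L) ^ 2) ^ (n - 2) * Real.exp (C * (M * L)) *
        (1 + L * M * Real.exp M / μ i) := by
        refine mul_le_mul_of_nonneg_left ?_ (by positivity)
        have hp := mul_pEdge_le_Lam (P := P) (fun i => (hμ i).le) K h0 i i
        rw [hL] at hp
        have hp' : α * pEdge P (K i) (K i) ≤ L / μ i := by
          rw [le_div_iff₀ (hμ i)]; linarith
        have hexp : Real.exp (α * M) - 1 ≤ α * M * Real.exp M := by
          have h2 := Real.add_one_le_exp (-(α * M))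
          have h3 : Real.exp (α * M) * Real.exp (-(α * M)) = 1 := by
            rw [← Real.exp_add]; simp
          have h4 : Real.exp (α * M) ≤ Real.exp M := Real.exp_le_exp.2 (by nlinarith)
          have h5 := mul_le_mul_of_nonneg_left h2 (Real.exp_pos (α * M)).le
          have h6 := mul_le_mul_of_nonneg_left h4 (mul_nonneg h0 hM0)
          nlinarith
        have h7 := mul_le_mul_of_nonneg_left hexp (pEdge_nonneg (P := P) (k := K i) (K i))
        have h8 := mul_le_mul_of_nonneg_right hp' (mul_nonneg hM0 (Real.exp_pos M).le)
        have h9 : L / μ i * (M * Real.exp M) = L * M * Real.exp M / μ i := by ring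
        rw [h9] at h8
        nlinarith
    _ = _ := by ring

lemma sum_weight {n r P : ℕ} {μ : Fin r → ℝ} (hμsum : ∑ i, μ i = 1) {K : Fin r → ℕ}
    (hK : ∀ i, K i ≤ P) (α : ℝ) (i : Fin r) :
    ∑ cfg : Config n r P, weight μ K α cfg = 1 := by
  classical
  have h := expect_isolated (P := P) (n := n) μ K α i ∅
  have hν : ∑ s : Fin r × Finset (Fin P), nodeWeight μ K s = 1 := by
    have := sum_nodeWeight_mul (P := P) μ K (fun _ => 1)
    simpa [sum_keyWeight (hK _), hμsum] using this
  have h2 := sum_prod_pi (V := Fin n) (fun _ => nodeWeight (P := P) μ K)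
  simp only [hν, prod_const_one] at h2
  simpa [expect, h2] using h

/-- Chebyshev's inequality for the number of isolated vertices of class `i`. -/
lemma Pr_no_isolated_mul_sq_le {n r P : ℕ} {μ : Fin r → ℝ} (hμ : ∀ i, 0 ≤ μ i)
    (hμsum : ∑ i, μ i = 1) {K : Fin r → ℕ} (hK : ∀ i, K i ≤ P) {α : ℝ} (h0 : 0 ≤ α) (h1 : α ≤ 1)
    (i : Fin r) {a b : ℝ} (hb : 0 ≤ b)
    (ha : ∀ x, expect μ K α (open scoped Classical in fun cfg : Config n r P =>
      if cfg.1 x = i ∧ isolated cfg x then 1 else 0) = a)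
    (hab : ∀ x y, x ≠ y → expect μ K α (open scoped Classical in fun cfg : Config n r P =>
      if (cfg.1 x = i ∧ isolated cfg x) ∧ (cfg.1 y = i ∧ isolated cfg y) then 1 else 0) ≤ b) :
    Pr (n := n) (P := P) μ K α (fun cfg => ∀ x, ¬ isolated cfg x) * (n * a) ^ 2 ≤
      n * a + n ^ 2 * b - (n * a) ^ 2 := by
  classical
  set I : Fin n → Config n r P → ℝ := fun x cfg =>
    if cfg.1 x = i ∧ isolated cfg x then 1 else 0 with hI
  set w : Config n r P → ℝ := weight μ K α with hw
  have hw0 : ∀ cfg, 0 ≤ w cfg := weight_nonneg hμ K h0 h1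
  have ha' : ∀ x, ∑ cfg, w cfg * I x cfg = a := by
    intro x
    rw [← ha x, expect]
  have hm : ∑ cfg, w cfg * ∑ x, I x cfg = n * a := by
    simp_rw [mul_sum]
    rw [Finset.sum_comm]
    simp [ha']
  have hsq : ∑ cfg, w cfg * (∑ x, I x cfg) ^ 2 ≤ n * a + n ^ 2 * b := by
    have hpt : ∀ x y, ∑ cfg, w cfg * (I x cfg * I y cfg) ≤ (if x = y then a else 0) + b := by
      intro x y
      by_cases hxy : x = y
      · subst hxy
        have : ∀ cfg, I x cfg * I x cfg = I x cfg := by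
          intro cfg; simp only [hI]; split_ifs <;> simp
        simp only [this, ha', if_true]
        linarith
      · rw [if_neg hxy, zero_add]
        refine le_trans (le_of_eq ?_) (hab x y hxy)
        unfold expect
        refine sum_congr rfl fun cfg _ => ?_
        congr 1
        simp only [hI]
        by_cases hx : cfg.1 x = i ∧ isolated cfg x <;>
          by_cases hy : cfg.1 y = i ∧ isolated cfg y <;> simp [hx, hy]
    calc ∑ cfg, w cfg * (∑ x, I x cfg) ^ 2
        = ∑ x, ∑ y, ∑ cfg, w cfg * (I x cfg * I y cfg) := by
          simp_rw [sq, sum_mul_sum, mul_sum]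
          rw [Finset.sum_comm]
          exact sum_congr rfl fun x _ => Finset.sum_comm
      _ ≤ ∑ x : Fin n, ∑ y : Fin n, ((if x = y then a else 0) + b) :=
          sum_le_sum fun x _ => sum_le_sum fun y _ => hpt x y
      _ = _ := by
          simp [sum_add_distrib]
          ring
  have hvar : ∑ cfg, w cfg * (∑ x, I x cfg - n * a) ^ 2 ≤ n * a + n ^ 2 * b - (n * a) ^ 2 := by
    have : ∀ cfg, w cfg * (∑ x, I x cfg - n * a) ^ 2 = w cfg * (∑ x, I x cfg) ^ 2 -
        2 * (n * a) * (w cfg * ∑ x, I x cfg) + (n * a) ^ 2 * w cfg := by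
      intro cfg; ring
    simp_rw [this, sum_add_distrib, sum_sub_distrib, ← mul_sum, hm]
    rw [hw, sum_weight hμsum hK α i]
    linarith
  refine le_trans ?_ hvar
  unfold Pr
  rw [sum_mul]
  refine sum_le_sum fun cfg _ => ?_
  split_ifs with hE
  · have : ∑ x, I x cfg = 0 := sum_eq_zero fun x _ => by simp [hI, hE x]
    rw [this]
    exact le_of_eq (by simp only [hw]; ring)
  · rw [zero_mul]
    exact mul_nonneg (hw0 cfg) (sq_nonneg _)

lemma Pr_nonneg {n r P : ℕ} {μ : Fin r → ℝ} (hμ : ∀ i, 0 ≤ μ i) (K : Fin r → ℕ) {α : ℝ}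
    (h0 : 0 ≤ α) (h1 : α ≤ 1) (E : Config n r P → Prop) : 0 ≤ Pr μ K α E := by
  unfold Pr
  refine sum_nonneg fun cfg _ => ?_
  split_ifs
  · exact weight_nonneg hμ K h0 h1 cfg
  · exact le_rfl

lemma Pr_no_isolated_le {n r P : ℕ} (hn : 2 ≤ n) {μ : Fin r → ℝ} (hμ : ∀ i, 0 < μ i)
    (hμsum : ∑ i, μ i = 1) {K : Fin r → ℕ} (hK : ∀ i, K i ≤ P) {α : ℝ} (h0 : 0 ≤ α) (h1 : α ≤ 1)
    (i : Fin r) {L M : ℝ} (hL : Lam μ K P α i = L) (hL0 : 0 ≤ L)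
    (hL1 : L < 1) (hM : M = n * L / (1 - L) ^ 2) :
    Pr (n := n) (P := P) μ K α (fun cfg => ∀ x, ¬ isolated cfg x) ≤
      Real.exp M / n / μ i + Real.exp ((∑ j, (μ j)⁻¹) * (M * L)) *
        (1 + L * M * Real.exp M / μ i) / (1 - L) ^ 2 - 1 := by
  classical
  have hn0 : (0 : ℝ) < n := by exact_mod_cast (by omega : 0 < n)
  have hb : 0 < 1 - L := by linarith
  have hM0 : 0 ≤ M := by rw [hM]; positivity
  have hμi := hμ i
  set R := Real.exp ((∑ j, (μ j)⁻¹) * (M * L)) * (1 + L * M * Real.exp M / μ i) with hR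
  have hR0 : 0 ≤ R := by positivity
  have hcheb := Pr_no_isolated_mul_sq_le (n := n) (fun i => (hμ i).le) hμsum hK h0 h1 i
    (a := μ i * (1 - L) ^ (n - 1)) (b := μ i ^ 2 * ((1 - L) ^ 2) ^ (n - 2) * R) (by positivity)
    (fun x => by rw [expect_isolated_one_eq hμsum hK α i x, hL])
    (fun x y hxy => expect_isolated_two_le_exp hμ hμsum hK h0 h1 i hxy hL hL0 hL1 hM)
  obtain ⟨m, rfl⟩ := Nat.exists_eq_add_of_le' hn
  simp only [Nat.add_sub_cancel] at hcheb
  have e1 : m + 2 - 1 = m + 1 := by omega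
  rw [e1] at hcheb
  set N : ℝ := ((m + 2 : ℕ) : ℝ) with hN
  have hpos : 0 < (N * (μ i * (1 - L) ^ (m + 1))) ^ 2 := by positivity
  rw [← le_div_iff₀ hpos] at hcheb
  refine hcheb.trans ?_
  have heq : (N * (μ i * (1 - L) ^ (m + 1)) +
      N ^ 2 * (μ i ^ 2 * ((1 - L) ^ 2) ^ m * R) - (N * (μ i * (1 - L) ^ (m + 1))) ^ 2) /
      (N * (μ i * (1 - L) ^ (m + 1))) ^ 2 =
      1 / (1 - L) ^ (m + 1) / N / μ i + R / (1 - L) ^ 2 - 1 := by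
    have : (1 - L) ≠ 0 := hb.ne'
    generalize 1 - L = t at this ⊢
    field_simp
    ring
  rw [heq]
  have hq : 1 / (1 - L) ^ (m + 1) ≤ Real.exp M := by
    rw [div_le_iff₀ (by positivity)]
    have h2 : 1 ≤ Real.exp (L / (1 - L)) * (1 - L) := by
      have := mul_le_mul_of_nonneg_right (Real.add_one_le_exp (L / (1 - L))) hb.le
      rw [add_mul, div_mul_cancel₀ _ hb.ne'] at this
      linarith
    calc (1 : ℝ) ≤ (Real.exp (L / (1 - L)) * (1 - L)) ^ (m + 1) := one_le_pow₀ h2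
      _ = Real.exp ((m + 1 : ℕ) * (L / (1 - L))) * (1 - L) ^ (m + 1) := by
          rw [mul_pow, ← Real.exp_nat_mul]
      _ ≤ _ := by
          refine mul_le_mul_of_nonneg_right (Real.exp_le_exp.2 ?_) (by positivity)
          rw [hM, mul_div_assoc]
          refine mul_le_mul (by rw [hN]; push_cast; linarith) ?_ (by positivity) hn0.le
          refine div_le_div_of_nonneg_left hL0 (by positivity) ?_
          nlinarith
  gcongr

lemma tendsto_log_sq_mul_rpow_div {s : ℝ} (hs : s < 1) :
    Tendsto (fun n : ℕ => Real.log n ^ 2 * (n : ℝ) ^ s / n) atTop (nhds 0) := by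
  have h := (isLittleO_log_rpow_rpow_atTop 2 (sub_pos.2 hs)).tendsto_div_nhds_zero
  refine (h.comp tendsto_natCast_atTop_atTop).congr' ?_
  filter_upwards [eventually_gt_atTop 0] with n hn
  have hn0 : (0 : ℝ) < n := by exact_mod_cast hn
  simp only [Function.comp]
  rw [Real.rpow_sub hn0, Real.rpow_one, Real.rpow_two]
  have := (Real.rpow_pos_of_pos hn0 s).ne'
  field_simp

end HetKey

/-- zero-law for absence of isolated nodes: if
`Λ_1(n) = c_n log n / n` with `c_n → c` and `0 < c < 1`, then the probability
that `G(n; μ, K_n, P_n, α_n)` has no isolated vertices tends to `0`. -/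
theorem isolated_nodes_zero_law
    (r : ℕ) (hr : 0 < r)
    (μ : Fin r → ℝ) (hμpos : ∀ i, 0 < μ i) (hμsum : ∑ i, μ i = 1)
    (K : ℕ → Fin r → ℕ) (Pn : ℕ → ℕ) (α : ℕ → ℝ)
    (hα0 : ∀ n, 0 < α n) (hα1 : ∀ n, α n < 1)
    (hK1 : ∀ n i, 1 ≤ K n i)
    (hKmono : ∀ n, Monotone (K n))
    (hKP : ∀ n i, 2 * K n i ≤ Pn n)
    (cn : ℕ → ℝ) (c : ℝ)
    (hcn : Tendsto cn atTop (nhds c)) (hc0 : 0 < c) (hc1 : c < 1)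
    (hΛ : ∀ n, 2 ≤ n →
      Lam μ (K n) (Pn n) (α n) ⟨0, hr⟩ = cn n * Real.log n / n) :
    Tendsto
      (fun n => Pr (n := n) (P := Pn n) μ (K n) (α n)
        (fun cfg => ∀ x, ¬ isolated cfg x))
      atTop (nhds 0) := by
  set i : Fin r := ⟨0, hr⟩
  set C : ℝ := ∑ j, (μ j)⁻¹
  set L : ℕ → ℝ := fun n => Lam μ (K n) (Pn n) (α n) i with hL
  set M : ℕ → ℝ := fun n => n * L n / (1 - L n) ^ 2 with hM
  have hLeq : ∀ᶠ n in atTop, cn n * (Real.log n / n) = L n := by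
    filter_upwards [eventually_ge_atTop 2] with n hn
    rw [hL, ← mul_div_assoc]
    exact (hΛ n hn).symm
  have hlog : Tendsto (fun n : ℕ => Real.log n / n) atTop (nhds 0) :=
    Real.isLittleO_log_id_atTop.tendsto_div_nhds_zero.comp tendsto_natCast_atTop_atTop
  have hLlim : Tendsto L atTop (nhds 0) := by
    have := (hcn.mul hlog).congr' hLeq
    simpa using this
  obtain ⟨s, hcs, hs1⟩ := exists_between hc1
  have hdlim : Tendsto (fun n => cn n / (1 - L n) ^ 2) atTop (nhds c) := by
    have := hcn.div ((tendsto_const_nhds (x := (1 : ℝ))).sub hLlim |>.pow 2) (by norm_num)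
    simpa [Pi.div_def] using this
  have hev : ∀ᶠ n : ℕ in atTop, 2 ≤ n ∧ 0 ≤ L n ∧ L n < 1 ∧ 0 ≤ M n ∧ 1 ≤ Real.log n ∧
      M n ≤ Real.log n ∧ Real.exp (M n) ≤ (n : ℝ) ^ s ∧ L n ≤ M n / n := by
    filter_upwards [eventually_ge_atTop 2, hLeq, hdlim.eventually_le_const hcs,
      hcn.eventually_const_le hc0, hLlim.eventually_lt_const one_pos,
      (Real.tendsto_log_atTop.comp tendsto_natCast_atTop_atTop).eventually_ge_atTop 1]
      with n hn hLn hd hc hL1 hlog1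
    have hn0 : (0 : ℝ) < n := by exact_mod_cast (by omega : 0 < n)
    simp only [Function.comp] at hlog1
    have hL0 : 0 ≤ L n := by
      rw [← hLn]
      have : 0 ≤ Real.log n := by linarith
      positivity
    have hpos : 0 < 1 - L n := by linarith
    have hMn : M n = cn n / (1 - L n) ^ 2 * Real.log n := by
      have : (n : ℝ) * L n = cn n * Real.log n := by
        rw [← hLn]; field_simp
      simp only [hM, this]
      ring
    have hMs : M n ≤ s * Real.log n := by
      rw [hMn]
      exact mul_le_mul_of_nonneg_right hd (by linarith)
    refine ⟨hn, hL0, hL1, ?_, hlog1, by nlinarith, ?_, ?_⟩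
    · simp only [hM]; positivity
    · rw [Real.rpow_def_of_pos hn0, mul_comm]
      exact Real.exp_le_exp.2 hMs
    · simp only [hM]
      rw [le_div_iff₀ hn0, le_div_iff₀ (by positivity), mul_comm (L n)]
      have : (1 - L n) ^ 2 ≤ 1 := by nlinarith
      exact mul_le_of_le_one_right (by positivity) this
  have hε := tendsto_log_sq_mul_rpow_div hs1
  have hexp : Tendsto (fun n => Real.exp (M n) / n) atTop (nhds 0) := by
    refine squeeze_zero' (Eventually.of_forall fun n => by positivity) ?_ hε
    filter_upwards [hev] with n ⟨hn, hL0, hL1, hM0, hlog1, hMlog, hMexp, hLM⟩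
    gcongr
    exact hMexp.trans (le_mul_of_one_le_left (by positivity) (one_le_pow₀ hlog1))
  have hLMexp : Tendsto (fun n => L n * M n * Real.exp (M n)) atTop (nhds 0) := by
    refine squeeze_zero' ?_ ?_ hε
    · filter_upwards [hev] with n ⟨hn, hL0, hL1, hM0, hlog1, hMlog, hMexp, hLM⟩
      positivity
    · filter_upwards [hev] with n ⟨hn, hL0, hL1, hM0, hlog1, hMlog, hMexp, hLM⟩
      calc L n * M n * Real.exp (M n) ≤ M n / n * M n * Real.exp (M n) := by gcongr
        _ = M n ^ 2 * Real.exp (M n) / n := by ring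
        _ ≤ _ := by gcongr
  have hML : Tendsto (fun n => M n * L n) atTop (nhds 0) := by
    refine squeeze_zero' ?_ ?_ hLMexp
    · filter_upwards [hev] with n ⟨hn, hL0, hL1, hM0, hlog1, hMlog, hMexp, hLM⟩
      positivity
    · filter_upwards [hev] with n ⟨hn, hL0, hL1, hM0, hlog1, hMlog, hMexp, hLM⟩
      rw [mul_comm (M n)]
      exact le_mul_of_one_le_right (by positivity) (Real.one_le_exp hM0)
  have hbound : Tendsto (fun n => Real.exp (M n) / n / μ i + Real.exp (C * (M n * L n)) *
      (1 + L n * M n * Real.exp (M n) / μ i) / (1 - L n) ^ 2 - 1) atTop (nhds 0) := by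
    have h1 := (((Real.continuous_exp.tendsto _).comp (hML.const_mul C)).mul
      ((hLMexp.div_const (μ i)).const_add 1)).div
      ((tendsto_const_nhds (x := (1 : ℝ))).sub hLlim |>.pow 2) (by norm_num)
    have h2 := ((hexp.div_const (μ i)).add h1).sub_const 1
    simpa using h2
  refine squeeze_zero' (Eventually.of_forall fun n =>
    Pr_nonneg (fun j => (hμpos j).le) (K n) (hα0 n).le (hα1 n).le _) ?_ hbound
  filter_upwards [hev] with n ⟨hn, hL0, hL1, hM0, hlog1, hMlog, hMexp, hLM⟩
  exact Pr_no_isolated_le hn hμpos hμsum (fun j => by have := hKP n j; omega) (hα0 n).le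
    (hα1 n).le i rfl hL0 hL1 rfl
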